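/- In a finite probability space with variables (U, X, W, A, Y), A binary, Y ≥ 0, assume: W ⟂ A | (X,U); there is a nonnegative h with E[Y | A,X,U] = E[h(W,A,X) | A,X,U] a.s.; Y^(a) ⟂ A | (X,U); positivity; consistency. Then E[Y^(a) | A=1−a] = E[h(W,a,X) | A=1−a], and consequently E[min_w (p(w | A=1−a, X)/p(w | A=a, X)) · E[Y | A=a, X] | A=1−a] ≤ E[Y^(a) | A=1−a] ≤ E[max_w (p(w | A=1−a, X)/p(w | A=a, X)) · E[Y | A=a, X] | A=1−a]. -/

import Mathlib

open Finset Real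
open scoped Classical

/-- Probability of an event under a pmf `P` on a finite sample space. -/
noncomputable def pr {Ω : Type*} [Fintype Ω] (P : Ω → ℝ) (E : Ω → Prop) : ℝ :=
  ∑ ω, if E ω then P ω else 0

/-- Expectation of `f` under `P`. -/
noncomputable def ex {Ω : Type*} [Fintype Ω] (P : Ω → ℝ) (f : Ω → ℝ) : ℝ :=
  ∑ ω, P ω * f ω

/-- Conditional expectation `E[f | E]`. -/
noncomputable def ce {Ω : Type*} [Fintype Ω] (P : Ω → ℝ) (f : Ω → ℝ) (E : Ω → Prop) : ℝ :=
  (∑ ω, if E ω then P ω * f ω else 0) / pr P E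

/-- Conditional probability `P(E | F)`. -/
noncomputable def cpr {Ω : Type*} [Fintype Ω] (P : Ω → ℝ) (E F : Ω → Prop) : ℝ :=
  pr P (fun ω => E ω ∧ F ω) / pr P F

/-- Unnormalised conditional expectation. -/
noncomputable def sE {Ω : Type*} [Fintype Ω] (P : Ω → ℝ) (f : Ω → ℝ) (E : Ω → Prop) : ℝ :=
  ∑ ω, if E ω then P ω * f ω else 0

lemma ce_eq {Ω : Type*} [Fintype Ω] (P : Ω → ℝ) (f : Ω → ℝ) (E : Ω → Prop) :
    ce P f E = sE P f E / pr P E := rfl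

lemma sE_congr {Ω : Type*} [Fintype Ω] (P : Ω → ℝ) {f g : Ω → ℝ} {E : Ω → Prop}
    (hfg : ∀ ω, E ω → f ω = g ω) : sE P f E = sE P g E := by
  unfold sE
  refine Finset.sum_congr rfl fun ω _ => ?_
  by_cases hE : E ω
  · simp [hE, hfg ω hE]
  · simp [hE]

lemma pr_congr {Ω : Type*} [Fintype Ω] (P : Ω → ℝ) {E F : Ω → Prop}
    (hEF : ∀ ω, E ω ↔ F ω) : pr P E = pr P F := by
  have : E = F := funext fun ω => propext (hEF ω)
  rw [this]

lemma sE_congr_event {Ω : Type*} [Fintype Ω] (P : Ω → ℝ) (f : Ω → ℝ) {E F : Ω → Prop}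
    (hEF : ∀ ω, E ω ↔ F ω) : sE P f E = sE P f F := by
  have : E = F := funext fun ω => propext (hEF ω)
  rw [this]

lemma pr_mono {Ω : Type*} [Fintype Ω] (P : Ω → ℝ) (hP : ∀ ω, 0 ≤ P ω) {E F : Ω → Prop}
    (hEF : ∀ ω, E ω → F ω) : pr P E ≤ pr P F := by
  unfold pr
  refine Finset.sum_le_sum fun ω _ => ?_
  by_cases hE : E ω
  · simp [hE, hEF ω hE]
  · by_cases hF : F ω <;> simp [hE, hF, hP ω]

lemma pr_nonneg {Ω : Type*} [Fintype Ω] (P : Ω → ℝ) (hP : ∀ ω, 0 ≤ P ω) (E : Ω → Prop) :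
    0 ≤ pr P E := by
  unfold pr
  refine Finset.sum_nonneg fun ω _ => ?_
  by_cases hE : E ω <;> simp [hE, hP ω]

lemma sE_partition {Ω V : Type*} [Fintype Ω] [Fintype V] (P f : Ω → ℝ) (E : Ω → Prop)
    (Z : Ω → V) : sE P f E = ∑ v, sE P f (fun ω => E ω ∧ Z ω = v) := by
  unfold sE
  rw [Finset.sum_comm]
  refine Finset.sum_congr rfl fun ω _ => ?_
  by_cases hE : E ω <;> simp [hE]

lemma sE_image {Ω T : Type*} [Fintype Ω] (P : Ω → ℝ) (E : Ω → Prop)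
    (Z : Ω → T) (f : T → ℝ) (s : Finset T) (hs : ∀ ω, Z ω ∈ s) :
    sE P (fun ω => f (Z ω)) E = ∑ t ∈ s, f t * pr P (fun ω => Z ω = t ∧ E ω) := by
  unfold sE pr
  simp_rw [Finset.mul_sum]
  rw [Finset.sum_comm]
  refine Finset.sum_congr rfl fun ω _ => ?_
  by_cases hE : E ω
  · simp [hE, hs ω, mul_comm]
  · simp [hE]

lemma sE_swap {Ω U X T : Type*} [Fintype Ω] (P : Ω → ℝ) (hP : ∀ ω, 0 ≤ P ω)
    (Uv : Ω → U) (Xv : Ω → X) (Av : Ω → Bool) (Z : Ω → T) (f : T → ℝ) (x : X) (u : U)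
    (hind : ∀ (t : T) (a' : Bool),
      pr P (fun ω => Z ω = t ∧ Av ω = a' ∧ Xv ω = x ∧ Uv ω = u) *
          pr P (fun ω => Xv ω = x ∧ Uv ω = u) =
        pr P (fun ω => Z ω = t ∧ Xv ω = x ∧ Uv ω = u) *
          pr P (fun ω => Av ω = a' ∧ Xv ω = x ∧ Uv ω = u))
    (hpos : ∀ a' : Bool, 0 < pr P fun ω => Av ω = a' ∧ Xv ω = x ∧ Uv ω = u)
    (a b : Bool) :
    sE P (fun ω => f (Z ω)) (fun ω => Av ω = a ∧ Xv ω = x ∧ Uv ω = u) *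
        pr P (fun ω => Av ω = b ∧ Xv ω = x ∧ Uv ω = u) =
      sE P (fun ω => f (Z ω)) (fun ω => Av ω = b ∧ Xv ω = x ∧ Uv ω = u) *
        pr P (fun ω => Av ω = a ∧ Xv ω = x ∧ Uv ω = u) := by
  have hs : ∀ ω, Z ω ∈ (Finset.univ.image Z) := fun ω =>
    Finset.mem_image_of_mem _ (Finset.mem_univ ω)
  rw [sE_image P _ Z f _ hs, sE_image P _ Z f _ hs, Finset.sum_mul, Finset.sum_mul]
  refine Finset.sum_congr rfl fun t _ => ?_
  have hq : 0 < pr P (fun ω => Xv ω = x ∧ Uv ω = u) :=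
    lt_of_lt_of_le (hpos a) (pr_mono P hP fun ω hω => hω.2)
  have h1 := hind t a
  have h2 := hind t b
  apply mul_right_cancel₀ hq.ne'
  linear_combination
    f t * pr P (fun ω => Av ω = b ∧ Xv ω = x ∧ Uv ω = u) * h1 -
      f t * pr P (fun ω => Av ω = a ∧ Xv ω = x ∧ Uv ω = u) * h2

/-- Theorem 1: single outcome-confounding-proxy identity and bounds:
`E[Y^(a) | A=1−a] = E[h(W,a,X) | A=1−a]` and the resulting min/max ratio bounds. -/
theorem single_outcome_proxy_bounds {Ω U X W : Type*} [Fintype Ω] [Fintype U] [Fintype X]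
    [Fintype W] [Nonempty W]
    (P : Ω → ℝ) (hP : ∀ ω, 0 ≤ P ω) (hP1 : ∑ ω, P ω = 1)
    (Uv : Ω → U) (Xv : Ω → X) (Wv : Ω → W) (Av : Ω → Bool) (Yv : Ω → ℝ)
    (a : Bool) (Ya : Ω → ℝ)
    (hY : ∀ ω, 0 ≤ Yv ω)
    -- W ⟂ A | (X,U)
    (hWA : ∀ (w : W) (a' : Bool) (x : X) (u : U),
      pr P (fun ω => Wv ω = w ∧ Av ω = a' ∧ Xv ω = x ∧ Uv ω = u) *
          pr P (fun ω => Xv ω = x ∧ Uv ω = u) =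
        pr P (fun ω => Wv ω = w ∧ Xv ω = x ∧ Uv ω = u) *
          pr P (fun ω => Av ω = a' ∧ Xv ω = x ∧ Uv ω = u))
    -- outcome bridge function h
    (h : W → Bool → X → ℝ) (hh : ∀ w a' x, 0 ≤ h w a' x)
    (hbridgeh : ∀ (a' : Bool) (x : X) (u : U),
      ce P Yv (fun ω => Av ω = a' ∧ Xv ω = x ∧ Uv ω = u) =
        ce P (fun ω => h (Wv ω) a' (Xv ω)) (fun ω => Av ω = a' ∧ Xv ω = x ∧ Uv ω = u))
    -- Y^(a) ⟂ A | (X,U)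
    (hYaA : ∀ (y : ℝ) (a' : Bool) (x : X) (u : U),
      pr P (fun ω => Ya ω = y ∧ Av ω = a' ∧ Xv ω = x ∧ Uv ω = u) *
          pr P (fun ω => Xv ω = x ∧ Uv ω = u) =
        pr P (fun ω => Ya ω = y ∧ Xv ω = x ∧ Uv ω = u) *
          pr P (fun ω => Av ω = a' ∧ Xv ω = x ∧ Uv ω = u))
    -- positivity
    (hpos : ∀ (a' : Bool) (x : X) (u : U),
      0 < pr P fun ω => Av ω = a' ∧ Xv ω = x ∧ Uv ω = u)
    (hposW : ∀ (w : W) (a' : Bool) (x : X),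
      0 < pr P fun ω => Wv ω = w ∧ Av ω = a' ∧ Xv ω = x)
    -- consistency
    (hcons : ∀ ω, Av ω = a → Yv ω = Ya ω) :
    ce P Ya (fun ω => Av ω = !a) =
        ce P (fun ω => h (Wv ω) a (Xv ω)) (fun ω => Av ω = !a) ∧
      (∑ x : X,
          (univ.inf' univ_nonempty fun w : W =>
              cpr P (fun ω => Wv ω = w) (fun ω => Av ω = !a ∧ Xv ω = x) /
                cpr P (fun ω => Wv ω = w) (fun ω => Av ω = a ∧ Xv ω = x)) *
            ce P Yv (fun ω => Av ω = a ∧ Xv ω = x) *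
            cpr P (fun ω => Xv ω = x) (fun ω => Av ω = !a)) ≤
        ce P Ya (fun ω => Av ω = !a) ∧
      ce P Ya (fun ω => Av ω = !a) ≤
        ∑ x : X,
          (univ.sup' univ_nonempty fun w : W =>
              cpr P (fun ω => Wv ω = w) (fun ω => Av ω = !a ∧ Xv ω = x) /
                cpr P (fun ω => Wv ω = w) (fun ω => Av ω = a ∧ Xv ω = x)) *
            ce P Yv (fun ω => Av ω = a ∧ Xv ω = x) *
            cpr P (fun ω => Xv ω = x) (fun ω => Av ω = !a) := by
  have key1 : ∀ x u, sE P Yv (fun ω => Av ω = a ∧ Xv ω = x ∧ Uv ω = u) =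
      sE P (fun ω => h (Wv ω) a x) (fun ω => Av ω = a ∧ Xv ω = x ∧ Uv ω = u) := by
    intro x u
    have h1 := hbridgeh a x u
    rw [ce_eq, ce_eq, div_left_inj' (hpos a x u).ne'] at h1
    rw [h1]
    exact sE_congr P fun ω hω => by rw [hω.2.1]
  have key2 : ∀ x u, sE P Ya (fun ω => Av ω = (!a) ∧ Xv ω = x ∧ Uv ω = u) =
      sE P (fun ω => h (Wv ω) a x) (fun ω => Av ω = (!a) ∧ Xv ω = x ∧ Uv ω = u) := by
    intro x u
    have h1 := sE_swap P hP Uv Xv Av Ya (fun y => y) x u (fun t a' => hYaA t a' x u)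
      (fun a' => hpos a' x u) (!a) a
    have h2 := sE_swap P hP Uv Xv Av Wv (fun w => h w a x) x u (fun t a' => hWA t a' x u)
      (fun a' => hpos a' x u) (!a) a
    have h3 : sE P Ya (fun ω => Av ω = a ∧ Xv ω = x ∧ Uv ω = u) =
        sE P Yv (fun ω => Av ω = a ∧ Xv ω = x ∧ Uv ω = u) :=
      sE_congr P fun ω hω => (hcons ω hω.1).symm
    apply mul_right_cancel₀ (hpos a x u).ne'
    rw [h2]
    refine h1.trans ?_
    rw [← key1, ← h3]
  have part : ∀ (f : Ω → ℝ) (b : Bool) (x : X), sE P f (fun ω => Av ω = b ∧ Xv ω = x) =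
      ∑ u, sE P f (fun ω => Av ω = b ∧ Xv ω = x ∧ Uv ω = u) := by
    intro f b x
    rw [sE_partition P f _ Uv]
    exact Finset.sum_congr rfl fun u _ => sE_congr_event P f fun ω => and_assoc
  have k1 : ∀ x, sE P Yv (fun ω => Av ω = a ∧ Xv ω = x) =
      ∑ w, h w a x * pr P (fun ω => Wv ω = w ∧ Av ω = a ∧ Xv ω = x) := by
    intro x
    rw [← sE_image P _ Wv (fun w => h w a x) Finset.univ (fun _ => Finset.mem_univ _),
      part, part]
    exact Finset.sum_congr rfl fun u _ => key1 x u
  have k2' : ∀ x, sE P Ya (fun ω => Av ω = (!a) ∧ Xv ω = x) =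
      sE P (fun ω => h (Wv ω) a x) (fun ω => Av ω = (!a) ∧ Xv ω = x) := by
    intro x
    rw [part, part]
    exact Finset.sum_congr rfl fun u _ => key2 x u
  have k2 : ∀ x, sE P Ya (fun ω => Av ω = (!a) ∧ Xv ω = x) =
      ∑ w, h w a x * pr P (fun ω => Wv ω = w ∧ Av ω = (!a) ∧ Xv ω = x) := by
    intro x
    rw [← sE_image P _ Wv (fun w => h w a x) Finset.univ (fun _ => Finset.mem_univ _), k2']
  have hAX : ∀ b x, 0 < pr P (fun ω => Av ω = b ∧ Xv ω = x) := fun b x =>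
    lt_of_lt_of_le (hposW (Classical.arbitrary W) b x) (pr_mono P hP fun ω hω => hω.2)
  have hcomm : ∀ x, pr P (fun ω => Xv ω = x ∧ Av ω = !a) =
      pr P (fun ω => Av ω = (!a) ∧ Xv ω = x) := fun x => pr_congr P fun ω => and_comm
  have hp := pr_nonneg P hP (fun ω => Av ω = !a)
  have hsum : ce P Ya (fun ω => Av ω = !a) =
      ∑ x, (∑ w, h w a x * pr P (fun ω => Wv ω = w ∧ Av ω = (!a) ∧ Xv ω = x)) /
        pr P (fun ω => Av ω = !a) := by
    rw [ce_eq, sE_partition P Ya _ Xv, Finset.sum_div]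
    exact Finset.sum_congr rfl fun x _ => by rw [k2]
  have hterm : ∀ (m : ℝ) (x : X), m * ce P Yv (fun ω => Av ω = a ∧ Xv ω = x) *
      cpr P (fun ω => Xv ω = x) (fun ω => Av ω = !a) =
      (∑ w, h w a x * (m * (pr P (fun ω => Wv ω = w ∧ Av ω = a ∧ Xv ω = x) /
        pr P (fun ω => Av ω = a ∧ Xv ω = x) * pr P (fun ω => Av ω = (!a) ∧ Xv ω = x)))) /
        pr P (fun ω => Av ω = !a) := by
    intro m x
    have hc : cpr P (fun ω => Xv ω = x) (fun ω => Av ω = !a) =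
      pr P (fun ω => Av ω = (!a) ∧ Xv ω = x) / pr P (fun ω => Av ω = !a) := by
      rw [← hcomm]; rfl
    rw [ce_eq, k1, hc, ← mul_div_assoc]
    congr 1
    rw [Finset.sum_div, Finset.mul_sum, Finset.sum_mul]
    exact Finset.sum_congr rfl fun w _ => by ring
  have hratio : ∀ w x, cpr P (fun ω => Wv ω = w) (fun ω => Av ω = !a ∧ Xv ω = x) /
      cpr P (fun ω => Wv ω = w) (fun ω => Av ω = a ∧ Xv ω = x) *
      (pr P (fun ω => Wv ω = w ∧ Av ω = a ∧ Xv ω = x) /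
        pr P (fun ω => Av ω = a ∧ Xv ω = x) * pr P (fun ω => Av ω = (!a) ∧ Xv ω = x)) =
      pr P (fun ω => Wv ω = w ∧ Av ω = (!a) ∧ Xv ω = x) := by
    intro w x
    unfold cpr
    have h1 := (hAX a x).ne'
    have h2 := (hAX (!a) x).ne'
    have h3 := (hposW w a x).ne'
    field_simp
  have hnn : ∀ w x, 0 ≤ pr P (fun ω => Wv ω = w ∧ Av ω = a ∧ Xv ω = x) /
        pr P (fun ω => Av ω = a ∧ Xv ω = x) * pr P (fun ω => Av ω = (!a) ∧ Xv ω = x) :=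
    fun w x => mul_nonneg (div_nonneg (hposW w a x).le (hAX a x).le) (hAX (!a) x).le
  refine ⟨?_, ?_, ?_⟩
  · rw [ce_eq, ce_eq, sE_partition P Ya _ Xv, sE_partition P (fun ω => h (Wv ω) a (Xv ω)) _ Xv]
    congr 1
    refine Finset.sum_congr rfl fun x _ => ?_
    rw [k2']
    exact sE_congr P fun ω hω => by rw [hω.2]
  · rw [hsum]
    refine Finset.sum_le_sum fun x _ => ?_
    rw [hterm]
    refine div_le_div_of_nonneg_right (Finset.sum_le_sum fun w _ => ?_) hp
    refine mul_le_mul_of_nonneg_left ?_ (hh w a x)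
    rw [← hratio w x]
    exact mul_le_mul_of_nonneg_right (Finset.inf'_le _ (Finset.mem_univ w)) (hnn w x)
  · rw [hsum]
    refine Finset.sum_le_sum fun x _ => ?_
    rw [hterm]
    refine div_le_div_of_nonneg_right (Finset.sum_le_sum fun w _ => ?_) hp
    refine mul_le_mul_of_nonneg_left ?_ (hh w a x)
    rw [← hratio w x]
    exact mul_le_mul_of_nonneg_right
      (Finset.le_sup' (fun w : W =>
              cpr P (fun ω => Wv ω = w) (fun ω => Av ω = !a ∧ Xv ω = x) /
                cpr P (fun ω => Wv ω = w) (fun ω => Av ω = a ∧ Xv ω = x))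
        (Finset.mem_univ w)) (hnn w x)
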